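/- Suppose q^8 ≠ 1. For n ∈ ℕ let F_n be the K-linear span in U_q^+(A_N) of the ordered monomials m_α with |α| ≤ n. Then {F_n} is an exhaustive algebra filtration of U_q^+(A_N): F_0 = K·1, F_n ⊆ F_{n+1} for all n, ⋃_{n∈ℕ} F_n = U_q^+(A_N), and F_{n₁} · F_{n₂} ⊆ F_{n₁+n₂} for all n₁, n₂ ∈ ℕ. Moreover F_n coincides with the standard filtration: F_n equals the K-span of all products x_{i₁j₁}x_{i₂j₂}⋯x_{i_rj_r} of at most n generators (r ≤ n), together with 1. -/

import Mathlib

/-- The index set Λ_N = {(i,j) : 1 ≤ i < j ≤ N+1}. -/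
def Lam (N : ℕ) : Type := {p : ℕ × ℕ // 1 ≤ p.1 ∧ p.1 < p.2 ∧ p.2 ≤ N + 1}

/-- Lexicographic linear order on Λ_N: (l,k) < (i,j) iff l < i, or l = i and k < j. -/
instance (N : ℕ) : LinearOrder (Lam N) :=
  LinearOrder.lift' (fun p => toLex p.val) (fun a b h => Subtype.ext (toLex.injective h))

/-- The Jimbo relations defining U_q^+(A_N): here `a = (i,j)` and `b = (m,n)`. -/
inductive JimboRel (K : Type) [Field K] (q : K) (N : ℕ) :
    FreeAlgebra K (Lam N) → FreeAlgebra K (Lam N) → Prop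
  /-- C1 : i = m < j < n -/
  | c1 : ∀ a b : Lam N, a.1.1 = b.1.1 → a.1.2 < b.1.2 →
      JimboRel K q N (FreeAlgebra.ι K b * FreeAlgebra.ι K a)
        ((q ^ 2)⁻¹ • (FreeAlgebra.ι K a * FreeAlgebra.ι K b))
  /-- C3 : i < m < j = n -/
  | c3 : ∀ a b : Lam N, a.1.1 < b.1.1 → a.1.2 = b.1.2 →
      JimboRel K q N (FreeAlgebra.ι K b * FreeAlgebra.ι K a)
        ((q ^ 2)⁻¹ • (FreeAlgebra.ι K a * FreeAlgebra.ι K b))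
  /-- C2 : i < m < n < j -/
  | c2 : ∀ a b : Lam N, a.1.1 < b.1.1 → b.1.2 < a.1.2 →
      JimboRel K q N (FreeAlgebra.ι K b * FreeAlgebra.ι K a)
        (FreeAlgebra.ι K a * FreeAlgebra.ι K b)
  /-- C6 : i < j < m < n -/
  | c6 : ∀ a b : Lam N, a.1.2 < b.1.1 →
      JimboRel K q N (FreeAlgebra.ι K b * FreeAlgebra.ι K a)
        (FreeAlgebra.ι K a * FreeAlgebra.ι K b)
  /-- C4 : i < m < j < n, with c = (i,n) and d = (m,j) -/
  | c4 : ∀ a b c d : Lam N, a.1.1 < b.1.1 → b.1.1 < a.1.2 → a.1.2 < b.1.2 →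
      c.1 = (a.1.1, b.1.2) → d.1 = (b.1.1, a.1.2) →
      JimboRel K q N (FreeAlgebra.ι K b * FreeAlgebra.ι K a)
        (FreeAlgebra.ι K a * FreeAlgebra.ι K b
          - (q ^ 2 - (q ^ 2)⁻¹) • (FreeAlgebra.ι K c * FreeAlgebra.ι K d))
  /-- C5 : i < j = m < n, with c = (i,n) -/
  | c5 : ∀ a b c : Lam N, a.1.2 = b.1.1 → c.1 = (a.1.1, b.1.2) →
      JimboRel K q N (FreeAlgebra.ι K b * FreeAlgebra.ι K a)
        ((q ^ 2) • (FreeAlgebra.ι K a * FreeAlgebra.ι K b) - q • FreeAlgebra.ι K c)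

/-- U_q^+(A_N): the free algebra on the X_{ij} modulo the Jimbo relations. -/
abbrev UqPlus (K : Type) [Field K] (q : K) (N : ℕ) := RingQuot (JimboRel K q N)

/-- x_{ij}: the image of the generator X_{ij} in U_q^+(A_N). -/
noncomputable def xg (K : Type) [Field K] (q : K) (N : ℕ) (p : Lam N) : UqPlus K q N :=
  RingQuot.mkAlgHom K (JimboRel K q N) (FreeAlgebra.ι K p)

/-- The ordered monomial m_α = ∏ x_{ij}^{α(i,j)}, the product taken in <_lex-increasing order. -/
noncomputable def mon (K : Type) [Field K] (q : K) (N : ℕ) (α : Lam N →₀ ℕ) : UqPlus K q N :=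
  ((α.support.sort (· ≤ ·)).map (fun p => xg K q N p ^ α p)).prod

/-- A monomial order on the finitely supported functions σ → ℕ: a well-founded strict
total order for which 0 is minimal and which is translation invariant. -/
def IsMonomialOrder (σ : Type) (r : (σ →₀ ℕ) → (σ →₀ ℕ) → Prop) : Prop :=
  WellFounded r ∧ (∀ α, ¬ r α α) ∧ (∀ α β γ, r α β → r β γ → r α γ) ∧
  (∀ α β, α ≠ β → r α β ∨ r β α) ∧ (∀ α, α ≠ 0 → r 0 α) ∧
  (∀ α β γ, r α β → r (α + γ) (β + γ))

/-- The filtration subspace F_n: the K-span of the ordered monomials of total degree ≤ n. -/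
noncomputable def Fil (K : Type) [Field K] (q : K) (N : ℕ) (n : ℕ) :
    Submodule K (UqPlus K q N) :=
  Submodule.span K {m : UqPlus K q N |
    ∃ α : Lam N →₀ ℕ, (α.sum fun _ k => k) ≤ n ∧ m = mon K q N α}

instance (N : ℕ) : Finite (Lam N) :=
  Set.Finite.to_subtype <|
    ((Set.finite_Iic (N + 1)).prod (Set.finite_Iic (N + 1))).subset fun p hp =>
      ⟨(hp.2.1.le.trans hp.2.2 : p.1 ≤ N + 1), hp.2.2⟩

theorem Lam.lt_iff {N : ℕ} {a b : Lam N} :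
    a < b ↔ a.1.1 < b.1.1 ∨ a.1.1 = b.1.1 ∧ a.1.2 < b.1.2 :=
  Prod.Lex.toLex_lt_toLex

section

variable (K : Type) [Field K] (q : K) (N : ℕ)

/-- The image in `U_q^+(A_N)` of a word in the generators. -/
noncomputable def wordProd (l : List (Lam N)) : UqPlus K q N := (l.map (xg K q N)).prod

variable {K q N}

theorem wordProd_append (l₁ l₂ : List (Lam N)) :
    wordProd K q N (l₁ ++ l₂) = wordProd K q N l₁ * wordProd K q N l₂ := by
  simp [wordProd]

/-- An ordered monomial is the product of the sorted word with the same multiplicities. -/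
theorem mon_eq_wordProd_sort (α : Lam N →₀ ℕ) :
    mon K q N α = wordProd K q N ((Finsupp.toMultiset α).sort (· ≤ ·)) := by
  have key : (Finsupp.toMultiset α).sort (· ≤ ·) =
      (α.support.sort (· ≤ ·)).flatMap fun p => List.replicate (α p) p := by
    refine List.Perm.eq_of_pairwise' (r := (· ≤ ·)) (Multiset.pairwise_sort _ _) ?_ ?_
    · refine List.pairwise_flatMap.2 ⟨fun a _ => List.pairwise_replicate.2 (Or.inr le_rfl), ?_⟩
      refine (Finset.pairwise_sort α.support (· ≤ ·)).imp fun {a b} hab x hx y hy => ?_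
      rw [List.eq_of_mem_replicate hx, List.eq_of_mem_replicate hy]
      exact hab
    · rw [← Multiset.coe_eq_coe, Multiset.sort_eq, ← Multiset.coe_bind, Finset.sort_eq,
        Finsupp.toMultiset_apply, Finsupp.sum, Finset.sum_eq_multiset_sum, Multiset.bind]
      simp [Multiset.join, Multiset.nsmul_singleton, Multiset.coe_replicate]
  rw [key, wordProd, List.map_flatMap, List.flatMap, List.prod_flatten, List.map_map, mon]
  simp [Function.comp_def]

/-- A descent `x_b x_a` with `a < b` lies in the span of the shortlex-smaller words. -/
theorem xg_mul_xg_mem_span {a b : Lam N} (hab : a < b) :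
    xg K q N b * xg K q N a ∈
      Submodule.span K (wordProd K q N '' {w | List.Shortlex (· < ·) w [b, a]}) := by
  have mem (w : List (Lam N)) (hw : List.Shortlex (· < ·) w [b, a]) : wordProd K q N w ∈
      Submodule.span K (wordProd K q N '' {w | List.Shortlex (· < ·) w [b, a]}) :=
    Submodule.subset_span ⟨w, hw, rfl⟩
  have mem₂ (c d : Lam N) (hc : c < b) : xg K q N c * xg K q N d ∈
      Submodule.span K (wordProd K q N '' {w | List.Shortlex (· < ·) w [b, a]}) := by
    simpa [wordProd] using mem [c, d] (.of_lex rfl (.rel hc))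
  have mem₁ (c : Lam N) : xg K q N c ∈
      Submodule.span K (wordProd K q N '' {w | List.Shortlex (· < ·) w [b, a]}) := by
    simpa [wordProd] using mem [c] (.of_length_lt (by simp))
  have hlt := Lam.lt_iff.1 hab
  obtain ⟨ha1, ha2, ha3⟩ := a.2
  obtain ⟨hb1, hb2, hb3⟩ := b.2
  have rel {u v} (h : JimboRel K q N u v) := RingQuot.mkAlgHom_rel K h
  rcases hlt with h1 | ⟨h1, h2⟩
  · rcases lt_trichotomy a.1.2 b.1.2 with h2 | h2 | h2
    · rcases lt_trichotomy a.1.2 b.1.1 with h3 | h3 | h3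
      · have := rel (.c6 a b h3)
        simp only [map_mul] at this
        exact this ▸ mem₂ a b hab
      · have := rel (.c5 a b ⟨(a.1.1, b.1.2), ha1, by grind, hb3⟩ h3 rfl)
        simp only [map_mul, map_sub, map_smul] at this
        exact this ▸ sub_mem (Submodule.smul_mem _ _ (mem₂ a b hab))
          (Submodule.smul_mem _ _ (mem₁ _))
      · have := rel (.c4 a b ⟨(a.1.1, b.1.2), ha1, by grind, hb3⟩
          ⟨(b.1.1, a.1.2), hb1, h3, ha3⟩ h1 h3 h2 rfl rfl)
        simp only [map_mul, map_sub, map_smul] at this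
        exact this ▸ sub_mem (mem₂ a b hab)
          (Submodule.smul_mem _ _ (mem₂ _ _ (Lam.lt_iff.2 (Or.inl h1))))
    · have := rel (.c3 a b h1 h2)
      simp only [map_mul, map_smul] at this
      exact this ▸ Submodule.smul_mem _ _ (mem₂ a b hab)
    · have := rel (.c2 a b h1 h2)
      simp only [map_mul] at this
      exact this ▸ mem₂ a b hab
  · have := rel (.c1 a b h1 h2)
    simp only [map_mul, map_smul] at this
    exact this ▸ Submodule.smul_mem _ _ (mem₂ a b hab)

theorem List.Shortlex.append_append {α : Type*} {r : α → α → Prop} {s t : List α}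
    (h : List.Shortlex r s t) (u v : List α) :
    List.Shortlex r (u ++ s ++ v) (u ++ t ++ v) := by
  rw [List.append_assoc, List.append_assoc]
  refine List.Shortlex.append_left ?_ u
  rcases List.shortlex_def.1 h with hlt | ⟨hl, hlex⟩
  · exact .of_length_lt (by simpa using hlt)
  · refine .of_lex (by simp [hl]) ?_
    clear h u
    induction hlex with
    | nil => simp at hl
    | cons _ ih => exact .cons (ih (by simpa using hl))
    | rel hr => exact .rel hr

theorem Fil_mono : Monotone (Fil K q N) := fun _ _ h =>
  Submodule.span_mono fun _ ⟨α, hα, hm⟩ => ⟨α, hα.trans h, hm⟩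

theorem wordProd_mem_Fil_of_sorted {l : List (Lam N)} (hl : l.Pairwise (· ≤ ·)) :
    wordProd K q N l ∈ Fil K q N l.length := by
  refine Submodule.subset_span ⟨Multiset.toFinsupp (l : Multiset (Lam N)), ?_, ?_⟩
  · refine (Finsupp.card_toMultiset _).ge.trans ?_
    rw [Multiset.toFinsupp_toMultiset, Multiset.coe_card]
  · rw [mon_eq_wordProd_sort, Multiset.toFinsupp_toMultiset]
    congr 1
    refine List.Perm.eq_of_pairwise' (r := (· ≤ ·)) hl (Multiset.pairwise_sort _ _) ?_
    rw [← Multiset.coe_eq_coe, Multiset.sort_eq]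

/-- Straightening: every word is a combination of ordered monomials of no larger degree. -/
theorem wordProd_mem_Fil (l : List (Lam N)) :
    wordProd K q N l ∈ Fil K q N l.length := by
  induction l using (List.Shortlex.wf (wellFounded_lt (α := Lam N))).induction with
  | _ l ih =>
  by_cases hl : l.IsChain (· ≤ ·)
  · exact wordProd_mem_Fil_of_sorted (List.isChain_iff_pairwise.1 hl)
  rw [List.isChain_iff_forall_rel_of_append_cons_cons] at hl
  push Not at hl
  obtain ⟨b, a, u, v, rfl, hab⟩ := hl
  have hw : wordProd K q N (u ++ b :: a :: v) =
      wordProd K q N u * (xg K q N b * xg K q N a) * wordProd K q N v := by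
    simp [wordProd, mul_assoc]
  rw [hw]
  refine Submodule.span_induction
    (p := fun y _ => wordProd K q N u * y * wordProd K q N v ∈
      Fil K q N (u ++ b :: a :: v).length) ?_ ?_ ?_ ?_ (xg_mul_xg_mem_span hab)
  · rintro _ ⟨w, hw, rfl⟩
    rw [← wordProd_append, ← wordProd_append]
    have hlt : List.Shortlex (· < ·) (u ++ w ++ v) (u ++ b :: a :: v) := by
      simpa using hw.append_append u v
    refine Fil_mono ?_ (ih _ hlt)
    rcases List.shortlex_def.1 hlt with h | h
    exacts [h.le, h.1.le]
  · simp
  · intro x y _ _ hx hy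
    rw [mul_add, add_mul]
    exact add_mem hx hy
  · intro c x _ hx
    rw [mul_smul_comm, smul_mul_assoc]
    exact Submodule.smul_mem _ _ hx

theorem Fil_eq_span_wordProd (n : ℕ) :
    Fil K q N n = Submodule.span K {m : UqPlus K q N |
      ∃ l : List (Lam N), l.length ≤ n ∧ m = (l.map (xg K q N)).prod} := by
  refine le_antisymm (Submodule.span_mono ?_) (Submodule.span_le.2 ?_)
  · rintro _ ⟨α, hα, rfl⟩
    refine ⟨(Finsupp.toMultiset α).sort (· ≤ ·), ?_, mon_eq_wordProd_sort α⟩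
    rwa [Multiset.length_sort, Finsupp.card_toMultiset]
  · rintro _ ⟨l, hl, rfl⟩
    exact Fil_mono hl (wordProd_mem_Fil l)

theorem Fil_zero : Fil K q N 0 = Submodule.span K {(1 : UqPlus K q N)} := by
  rw [Fil_eq_span_wordProd]
  congr 1
  ext m
  simp [List.length_eq_zero_iff]

theorem Fil_mul_le (n₁ n₂ : ℕ) :
    Fil K q N n₁ * Fil K q N n₂ ≤ Fil K q N (n₁ + n₂) := by
  simp only [Fil_eq_span_wordProd, Submodule.span_mul_span]
  refine Submodule.span_mono ?_
  rintro _ ⟨_, ⟨l₁, h₁, rfl⟩, _, ⟨l₂, h₂, rfl⟩, rfl⟩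
  exact ⟨l₁ ++ l₂, by simpa using add_le_add h₁ h₂, by simp⟩

theorem exists_mem_Fil (u : UqPlus K q N) : ∃ n, u ∈ Fil K q N n := by
  obtain ⟨f, rfl⟩ := RingQuot.mkAlgHom_surjective K (JimboRel K q N) u
  induction f using FreeAlgebra.induction with
  | grade0 r =>
    refine ⟨0, ?_⟩
    rw [Fil_zero, AlgHom.commutes, Algebra.algebraMap_eq_smul_one]
    exact Submodule.smul_mem _ _ (Submodule.mem_span_singleton_self _)
  | grade1 x =>
    refine ⟨1, ?_⟩
    simpa [wordProd, xg] using wordProd_mem_Fil (K := K) (q := q) [x]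
  | mul f g hf hg =>
    obtain ⟨m, hm⟩ := hf
    obtain ⟨n, hn⟩ := hg
    rw [map_mul]
    exact ⟨m + n, Fil_mul_le m n (Submodule.mul_mem_mul hm hn)⟩
  | add f g hf hg =>
    obtain ⟨m, hm⟩ := hf
    obtain ⟨n, hn⟩ := hg
    rw [map_add]
    exact ⟨max m n, add_mem (Fil_mono (le_max_left m n) hm) (Fil_mono (le_max_right m n) hn)⟩

end

/-- If q^8 ≠ 1 then {F_n} is an exhaustive algebra filtration of U_q^+(A_N):
F_0 = K·1, F_n ⊆ F_{n+1}, ⋃ F_n = U_q^+(A_N), F_{n₁}·F_{n₂} ⊆ F_{n₁+n₂}; moreover F_n is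
the K-span of all products of at most n generators (the empty product being 1). -/
theorem uqPlus_standard_filtration (K : Type) [Field K] (q : K) (hq0 : q ≠ 0)
    (hq8 : q ^ 8 ≠ 1) (N : ℕ) (hN : 1 ≤ N) :
    Fil K q N 0 = Submodule.span K {(1 : UqPlus K q N)} ∧
    (∀ n : ℕ, Fil K q N n ≤ Fil K q N (n + 1)) ∧
    (∀ u : UqPlus K q N, ∃ n : ℕ, u ∈ Fil K q N n) ∧
    (∀ n₁ n₂ : ℕ, Fil K q N n₁ * Fil K q N n₂ ≤ Fil K q N (n₁ + n₂)) ∧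
    (∀ n : ℕ, Fil K q N n =
      Submodule.span K {m : UqPlus K q N |
        ∃ l : List (Lam N), l.length ≤ n ∧ m = (l.map (xg K q N)).prod}) := by
  exact ⟨Fil_zero, fun n => Fil_mono n.le_succ, exists_mem_Fil, Fil_mul_le, Fil_eq_span_wordProd⟩
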